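/- Let n ≥ 1 and let f, g : ℝ^n → ℝ be smooth functions with f(0) = g(0) = 0, such that 0 is the unique critical point of f and the unique critical point of g (Df_x = 0 ⟺ x = 0, and likewise for g), the second derivatives (Hessians) B_f = D²f(0) and B_g = D²g(0) are nondegenerate symmetric bilinear forms, and there exists a linear automorphism T of ℝ^n with B_g(v, w) = B_f(Tv, Tw) for all v, w (f and g have the same Morse index at 0). Then for every open neighborhood V of 0 there exists a smooth function h : ℝ^n × ℝ → ℝ such that: (i) h(x, c) = f(x) for all x ∉ V and all c ∈ [0, 1]; (ii) h(x, 0) = f(x) for all x; (iii) there exists an open neighborhood U of 0 with h(x, 1) = g(x) for all x ∈ U; and (iv) 0 is the unique critical point of the function x ↦ h(x, 1). (Interpolation of Morse functions with a single critical point of the same index.) -/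

import Mathlib

open Filter Topology

theorem aux_sq {n : ℕ} (i j : Fin n) (hij : i ≠ j) :
    (Matrix.transvection i j (1:ℝ) * Matrix.transvection j i (-1) * Matrix.transvection i j 1) *
    (Matrix.transvection i j (1:ℝ) * Matrix.transvection j i (-1) * Matrix.transvection i j 1)
     = Matrix.diagonal (fun k => if k = i ∨ k = j then (-1:ℝ) else 1) := by
  have hd : Matrix.diagonal (fun k => if k = i ∨ k = j then (-1:ℝ) else 1) =
      1 - (2:ℝ) • (Matrix.single i i (1:ℝ) + Matrix.single j j 1) := by
    ext a b
    by_cases hab : a = b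
    · subst hab
      by_cases h1 : a = i
      · subst h1; simp [Matrix.single_apply, hij.symm]; norm_num
      · by_cases h2 : a = j
        · subst h2; simp [Matrix.single_apply, hij]; norm_num
        · simp [Matrix.single_apply, h1, h2, Ne.symm h1, Ne.symm h2]
    · have : ∀ k, ¬ (k = a ∧ k = b) := by rintro k ⟨rfl, rfl⟩; exact hab rfl
      simp [Matrix.single_apply, hab, this]
  rw [hd]
  have e : Matrix.single j i (-1:ℝ) = - Matrix.single j i (1:ℝ) := by
    ext a b; simp [Matrix.single_apply]; split_ifs <;> simp
  unfold Matrix.transvection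
  rw [e]
  simp only [mul_add, add_mul, mul_one, one_mul, mul_neg, neg_mul, neg_neg, ← Matrix.mul_assoc,
    Matrix.single_mul_single_same, Matrix.single_mul_single_of_ne _ _ _ _ hij.symm,
    Matrix.single_mul_single_of_ne _ _ _ _ hij, zero_mul, neg_zero, add_zero, zero_add]
  module

theorem mem_transvection {n : ℕ} (S : Submonoid (Matrix (Fin n) (Fin n) ℝ))
    (hS : ∀ᶠ M in 𝓝 (1 : Matrix (Fin n) (Fin n) ℝ), M ∈ S) (i j : Fin n) (hij : i ≠ j) (c : ℝ) :
    Matrix.transvection i j c ∈ S := by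
  have ht : Tendsto (fun N : ℕ => Matrix.transvection i j (c / (N:ℝ))) atTop (𝓝 1) := by
    have h1 : Continuous (fun c : ℝ => Matrix.transvection i j c) := by
      refine continuous_matrix fun a b => ?_
      simp only [Matrix.transvection, Matrix.add_apply, Matrix.single_apply]
      split_ifs <;> fun_prop
    have h2 := (h1.tendsto 0).comp (tendsto_const_div_atTop_nhds_zero_nat c)
    simpa [Function.comp_def] using h2
  obtain ⟨N, hN, hN0⟩ := ((ht.eventually hS).and (eventually_gt_atTop 0)).exists
  have : ∀ k : ℕ, Matrix.transvection i j (c / (N:ℝ)) ^ k = Matrix.transvection i j (k * (c / N)) := by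
    intro k
    induction k with
    | zero => simp
    | succ k ih =>
      rw [pow_succ, ih, Matrix.transvection_mul_transvection_same _ _ hij]; congr 1; push_cast; ring
  have h := S.pow_mem hN N
  rw [this] at h
  convert h using 2
  have : (N:ℝ) ≠ 0 := by positivity
  field_simp

theorem mem_posdiag {n : ℕ} (S : Submonoid (Matrix (Fin n) (Fin n) ℝ))
    (hS : ∀ᶠ M in 𝓝 (1 : Matrix (Fin n) (Fin n) ℝ), M ∈ S) (D : Fin n → ℝ) (hD : ∀ i, 0 < D i) :
    Matrix.diagonal D ∈ S := by
  have ht : Tendsto (fun N : ℕ => Matrix.diagonal (fun i => (D i) ^ ((1:ℝ) / (N:ℝ)))) atTop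
      (𝓝 (1 : Matrix (Fin n) (Fin n) ℝ)) := by
    have h1 : Continuous (fun c : ℝ => Matrix.diagonal (fun i => (D i) ^ c)) := by
      refine Continuous.matrix_diagonal ?_
      refine continuous_pi fun i => ?_
      exact Real.continuous_const_rpow (hD i).ne'
    have h2 := (h1.tendsto 0).comp (tendsto_const_div_atTop_nhds_zero_nat 1)
    simpa [Function.comp_def] using h2
  obtain ⟨N, hN, hN0⟩ := ((ht.eventually hS).and (eventually_gt_atTop 0)).exists
  have h := S.pow_mem hN N
  rw [Matrix.diagonal_pow] at h
  have e : (fun i => (D i) ^ ((1:ℝ) / (N:ℝ))) ^ N = D := by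
    ext i
    simp only [Pi.pow_apply]
    rw [← Real.rpow_natCast, ← Real.rpow_mul (hD i).le]
    have : (N:ℝ) ≠ 0 := by positivity
    field_simp; simp
  rw [e] at h
  exact h

theorem mem_diag {n : ℕ} (S : Submonoid (Matrix (Fin n) (Fin n) ℝ))
    (hS : ∀ᶠ M in 𝓝 (1 : Matrix (Fin n) (Fin n) ℝ), M ∈ S) (m : ℕ) : ∀ (D : Fin n → ℝ),
    0 < ∏ i, D i → (Finset.univ.filter (fun i => D i < 0)).card = m → Matrix.diagonal D ∈ S := by
  induction m using Nat.strong_induction_on with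
  | _ m ih =>
  intro D hD hm
  have hne : ∀ i, D i ≠ 0 := fun i hi => hD.ne' (Finset.prod_eq_zero (Finset.mem_univ i) hi)
  by_cases hpos : ∀ i, 0 < D i
  · exact mem_posdiag S hS D hpos
  push Not at hpos
  obtain ⟨i, hi⟩ := hpos
  have hi' : D i < 0 := lt_of_le_of_ne hi (hne i)
  have : ∃ j, j ≠ i ∧ D j < 0 := by
    by_contra hcon
    push Not at hcon
    rw [← Finset.mul_prod_erase _ _ (Finset.mem_univ i)] at hD
    have : 0 ≤ ∏ x ∈ Finset.univ.erase i, D x :=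
      Finset.prod_nonneg fun j hj => hcon j (Finset.ne_of_mem_erase hj)
    nlinarith
  obtain ⟨j, hji, hj⟩ := this
  set s : Fin n → ℝ := fun k => if k = i ∨ k = j then (-1:ℝ) else 1 with hs
  have hsS : Matrix.diagonal s ∈ S := by
    rw [hs, ← aux_sq i j hji.symm]
    have h1 := mem_transvection S hS i j hji.symm 1
    have h2 := mem_transvection S hS j i hji (-1)
    exact S.mul_mem (S.mul_mem (S.mul_mem h1 h2) h1) (S.mul_mem (S.mul_mem h1 h2) h1)
  have hss : ∀ k, s k * s k = 1 := by intro k; simp only [hs]; split_ifs <;> norm_num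
  have hprod : ∏ k, s k = 1 := by
    have := congrArg Matrix.det (aux_sq i j hji.symm)
    rw [Matrix.det_diagonal] at this
    rw [← hs] at this
    rw [← this]
    simp [Matrix.det_mul, Matrix.det_transvection_of_ne, hji, hji.symm]
  have hD' : Matrix.diagonal (fun k => D k * s k) ∈ S := by
    refine ih _ ?_ _ ?_ rfl
    · rw [← hm]
      apply Finset.card_lt_card
      rw [Finset.ssubset_iff_of_subset]
      · refine ⟨i, by simp [hi'], ?_⟩
        simp [hs]; linarith
      · intro k
        simp only [Finset.mem_filter, Finset.mem_univ, true_and, hs]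
        split_ifs with h
        · rcases h with rfl | rfl
          · intro; assumption
          · intro; assumption
        · simp
    · rw [Finset.prod_mul_distrib, hprod, mul_one]; exact hD
  have := S.mul_mem hD' hsS
  rw [Matrix.diagonal_mul_diagonal] at this
  simpa [mul_assoc, hss] using this

theorem mem_of_det_pos {n : ℕ} (S : Submonoid (Matrix (Fin n) (Fin n) ℝ))
    (hS : ∀ᶠ M in 𝓝 (1 : Matrix (Fin n) (Fin n) ℝ), M ∈ S) (M : Matrix (Fin n) (Fin n) ℝ)
    (hM : 0 < M.det) : M ∈ S := by
  obtain ⟨L, L', D, rfl⟩ := Matrix.Pivot.exists_list_transvec_mul_diagonal_mul_list_transvec M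
  have hL : ∀ L : List (Matrix.TransvectionStruct (Fin n) ℝ),
      (L.map Matrix.TransvectionStruct.toMatrix).prod ∈ S := by
    intro L
    apply S.list_prod_mem
    intro x hx
    obtain ⟨t, -, rfl⟩ := List.mem_map.1 hx
    exact mem_transvection S hS _ _ t.hij _
  simp only [Matrix.det_mul, Matrix.TransvectionStruct.det_toMatrix_prod, one_mul, mul_one,
    Matrix.det_diagonal] at hM
  exact S.mul_mem (S.mul_mem (hL _) (mem_diag S hS _ D hM rfl)) (hL _)

theorem exists_bump (E : Type*) [NormedAddCommGroup E] [NormedSpace ℝ E] [FiniteDimensional ℝ E] :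
    ∃ M : ℝ, 0 ≤ M ∧ ∀ ε : ℝ, 0 < ε → ∃ χ : E → ℝ, ContDiff ℝ (⊤ : ℕ∞) χ ∧
      (∀ x, ‖x‖ ≤ ε → χ x = 1) ∧ (∀ x, 2 * ε ≤ ‖x‖ → χ x = 0) ∧ (∀ x, |χ x| ≤ 1) ∧
      (∀ x, ‖fderiv ℝ χ x‖ * ‖x‖ ≤ M) := by
  let b : ContDiffBump (0 : E) := ⟨1, 2, one_pos, one_lt_two⟩
  have hb : ContDiff ℝ (⊤ : ℕ∞) (b : E → ℝ) := b.contDiff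
  obtain ⟨K, hK⟩ := (b.hasCompactSupport.fderiv (𝕜 := ℝ)).exists_bound_of_continuous
    (hb.continuous_fderiv (by simp))
  have hK0 : 0 ≤ K := (norm_nonneg _).trans (hK 0)
  refine ⟨K * 2, by positivity, fun ε hε => ⟨fun x => b (ε⁻¹ • x), hb.comp (contDiff_const_smul _), ?_, ?_, ?_, ?_⟩⟩
  · intro x hx
    apply b.one_of_mem_closedBall
    simp only [mem_closedBall_zero_iff, norm_smul, norm_inv, Real.norm_eq_abs, abs_of_pos hε, b]
    rw [inv_mul_le_iff₀ hε]; linarith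
  · intro x hx
    apply b.zero_of_le_dist
    simp only [dist_zero_right, norm_smul, norm_inv, Real.norm_eq_abs, abs_of_pos hε, b]
    rw [le_inv_mul_iff₀ hε]; linarith
  · intro x
    rw [abs_of_nonneg b.nonneg]; exact b.le_one
  · intro x
    by_cases hx : ‖x‖ ≤ 2 * ε
    · have : HasFDerivAt (fun x => b (ε⁻¹ • x)) ((fderiv ℝ b (ε⁻¹ • x)).comp (ε⁻¹ • ContinuousLinearMap.id ℝ E)) x :=
        ((hb.differentiable (by simp) _).hasFDerivAt).comp x ((hasFDerivAt_id x).const_smul ε⁻¹)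
      rw [this.fderiv, ContinuousLinearMap.comp_smul, ContinuousLinearMap.comp_id, norm_smul,
        norm_inv, Real.norm_eq_abs, abs_of_pos hε]
      have h1 := hK (ε⁻¹ • x)
      have h2 : ε⁻¹ * ‖x‖ ≤ 2 := by rw [inv_mul_le_iff₀ hε]; linarith
      calc _ = ‖fderiv ℝ b (ε⁻¹ • x)‖ * (ε⁻¹ * ‖x‖) := by ring
        _ ≤ K * 2 := by gcongr
    · have : (fun x => b (ε⁻¹ • x)) =ᶠ[𝓝 x] fun _ => (0:ℝ) := by
        filter_upwards [(isOpen_lt continuous_const continuous_norm).mem_nhds (not_le.1 hx)] with y hy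
        apply b.zero_of_le_dist
        simp only [dist_zero_right, norm_smul, norm_inv, Real.norm_eq_abs, abs_of_pos hε, b]
        have hy1 : 2 * ε < ‖y‖ := hy
        rw [le_inv_mul_iff₀ hε]; linarith
      rw [this.fderiv_eq]; simp; positivity

theorem same_hessian {E : Type*} [NormedAddCommGroup E] [NormedSpace ℝ E] [FiniteDimensional ℝ E]
    (f g : E → ℝ) (hf : ContDiff ℝ (⊤ : ℕ∞) f) (hg : ContDiff ℝ (⊤ : ℕ∞) g)
    (hf0 : f 0 = 0) (hg0 : g 0 = 0)
    (hfc : ∀ x, fderiv ℝ f x = 0 ↔ x = 0) (hgc : fderiv ℝ g 0 = 0)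
    (hfnd : ∀ v, (∀ w, fderiv ℝ (fderiv ℝ f) 0 v w = 0) → v = 0)
    (hH : fderiv ℝ (fderiv ℝ g) 0 = fderiv ℝ (fderiv ℝ f) 0)
    (V : Set E) (hV : V ∈ 𝓝 (0:E)) :
    ∃ F : E → ℝ, ContDiff ℝ (⊤ : ℕ∞) F ∧ (∀ x ∉ V, F x = f x) ∧ (∀ᶠ x in 𝓝 0, F x = g x) ∧
      (∀ x, fderiv ℝ F x = 0 ↔ x = 0) := by
  obtain ⟨M, hM0, hM⟩ := exists_bump E
  have hdf : ContDiff ℝ 1 (fderiv ℝ f) := hf.fderiv_right (by norm_cast)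
  have hdg : ContDiff ℝ 1 (fderiv ℝ g) := hg.fderiv_right (by norm_cast)
  have hf1 : Differentiable ℝ f := hf.differentiable (by simp)
  have hg1 : Differentiable ℝ g := hg.differentiable (by simp)
  set B := fderiv ℝ (fderiv ℝ f) 0 with hB
  have hBf : HasFDerivAt (fderiv ℝ f) B 0 := (hdf.differentiable (by simp) 0).hasFDerivAt
  have hBg : HasFDerivAt (fderiv ℝ g) B 0 := hH ▸ (hdg.differentiable (by simp) 0).hasFDerivAt
  have hinj : Function.Injective B := by
    rw [injective_iff_map_eq_zero]
    intro v hv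
    exact hfnd v (fun w => by simp [hv])
  obtain ⟨K, hK0, hK⟩ := (B : E →ₗ[ℝ] (E →L[ℝ] ℝ)).exists_antilipschitzWith (LinearMap.ker_eq_bot.2 hinj)
  have hK' : ∀ x, ‖x‖ ≤ K * ‖B x‖ := fun x => by
    simpa using hK.le_mul_dist x 0
  have hKp : (0:ℝ) < K := by exact_mod_cast hK0
  -- lower bound
  have hlow : ∀ᶠ x in 𝓝 (0:E), ‖x‖ ≤ 2 * K * ‖fderiv ℝ f x‖ := by
    have := hBf.isLittleO.def (c := 1 / (2 * K)) (by positivity)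
    filter_upwards [this] with x hx
    rw [(hfc 0).2 rfl, sub_zero, sub_zero] at hx
    have h1 := hK' x
    have h2 : ‖B x‖ ≤ ‖fderiv ℝ f x‖ + ‖fderiv ℝ f x - B x‖ := by
      have := norm_sub_norm_le (B x) (B x - fderiv ℝ f x)
      rw [norm_sub_rev (B x)] at this
      simp at this
      linarith
    have h3 : K * (1 / (2 * K) * ‖x‖) = ‖x‖ / 2 := by field_simp
    have h4 : K * ‖B x‖ ≤ K * (‖fderiv ℝ f x‖ + 1 / (2 * K) * ‖x‖) := by
      gcongr; linarith
    linarith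
  set k : E → ℝ := fun x => g x - f x with hk
  have hkd : ∀ x, HasFDerivAt k (fderiv ℝ g x - fderiv ℝ f x) x := fun x =>
    (hg1 x).hasFDerivAt.sub (hf1 x).hasFDerivAt
  set η : ℝ := 1 / (4 * K * (1 + M)) with hη
  have hηp : 0 < η := by positivity
  have hsm : ∀ᶠ x in 𝓝 (0:E), ‖fderiv ℝ g x - fderiv ℝ f x‖ ≤ η * ‖x‖ := by
    have := (hBg.sub hBf).isLittleO.def hηp
    filter_upwards [this] with x hx
    simpa [(hfc 0).2 rfl, hgc] using hx
  obtain ⟨δ, hδ, hball⟩ := Metric.eventually_nhds_iff_ball.1 ((hlow.and hsm).and hV)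
  have hkb : ∀ x ∈ Metric.ball (0:E) δ, |k x| ≤ η * ‖x‖ * ‖x‖ := by
    intro x hx
    have := (convex_closedBall (0:E) ‖x‖).norm_image_sub_le_of_norm_hasFDerivWithin_le (f := k)
      (f' := fun x => fderiv ℝ g x - fderiv ℝ f x) (C := η * ‖x‖)
      (fun y _ => (hkd y).hasFDerivWithinAt) (fun y hy => by
        have hy' : ‖y‖ ≤ ‖x‖ := by simpa using hy
        have hyb : y ∈ Metric.ball (0:E) δ := by
          rw [mem_ball_zero_iff] at hx ⊢; linarith
        refine (hball y hyb).1.2.trans ?_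
        gcongr) (x := 0) (y := x) (by simp) (by simp)
    simpa [hk, hf0, hg0] using this
  obtain ⟨χ, hχ, hχ1, hχ0, hχb, hχM⟩ := hM (δ / 4) (by positivity)
  have hχd : Differentiable ℝ χ := hχ.differentiable (by simp)
  have hFd : ∀ x, HasFDerivAt (fun x => f x + χ x * k x)
      (fderiv ℝ f x + (χ x • (fderiv ℝ g x - fderiv ℝ f x) + k x • fderiv ℝ χ x)) x := fun x =>
    (hf1 x).hasFDerivAt.add ((hχd x).hasFDerivAt.mul (hkd x))
  refine ⟨fun x => f x + χ x * k x, hf.add (hχ.mul (hg.sub hf)), ?_, ?_, ?_⟩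
  · intro x hx
    have : δ ≤ ‖x‖ := by
      by_contra hc
      exact hx (hball x (by simpa using hc)).2
    simp [hχ0 x (by linarith)]
  · filter_upwards [Metric.closedBall_mem_nhds (0:E) (show 0 < δ / 4 by positivity)] with x hx
    simp [hχ1 x (by simpa using hx), hk]
  · intro x
    rw [(hFd x).fderiv]
    by_cases hx : ‖x‖ < δ
    · have hxb : x ∈ Metric.ball (0:E) δ := by simpa using hx
      constructor
      · intro h
        by_contra hx0
        have hxp : 0 < ‖x‖ := norm_pos_iff.2 hx0
        obtain ⟨⟨h1, h2⟩, -⟩ := hball x hxb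
        have h3 : ‖fderiv ℝ f x‖ ≤ η * (1 + M) * ‖x‖ := by
          rw [eq_neg_of_add_eq_zero_left h, norm_neg]
          refine (norm_add_le _ _).trans ?_
          rw [norm_smul, norm_smul, Real.norm_eq_abs, Real.norm_eq_abs]
          have a1 : |χ x| * ‖fderiv ℝ g x - fderiv ℝ f x‖ ≤ 1 * (η * ‖x‖) := by
            gcongr; exact hχb x
          have a2 : |k x| * ‖fderiv ℝ χ x‖ ≤ η * ‖x‖ * M :=
            calc _ ≤ (η * ‖x‖ * ‖x‖) * ‖fderiv ℝ χ x‖ := by gcongr; exact hkb x hxb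
              _ = η * ‖x‖ * (‖fderiv ℝ χ x‖ * ‖x‖) := by ring
              _ ≤ _ := by gcongr; exact hχM x
          linarith
        have h4 : 2 * K * (η * (1 + M) * ‖x‖) = ‖x‖ / 2 := by
          rw [hη]; field_simp; norm_num
        have h5 : 2 * K * ‖fderiv ℝ f x‖ ≤ 2 * K * (η * (1 + M) * ‖x‖) := by gcongr
        linarith
      · rintro rfl
        simp [hk, hf0, hg0, hgc, (hfc 0).2 rfl]
    · have hx' : 2 * (δ / 4) < ‖x‖ := by linarith
      have : χ =ᶠ[𝓝 x] fun _ => (0:ℝ) := by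
        filter_upwards [(isOpen_lt continuous_const continuous_norm).mem_nhds hx'] with y hy
        exact hχ0 y (le_of_lt hy)
      rw [this.fderiv_eq, this.eq_of_nhds]
      simpa using hfc x

/-- `A` is the derivative at `0` of a smooth map, with invertible derivatives, vanishing only at `0`
and equal to the identity off an arbitrarily small neighborhood of `0`. -/
def LocExt {E : Type*} [NormedAddCommGroup E] [NormedSpace ℝ E] (A : E →L[ℝ] E) : Prop :=
  ∀ V ∈ 𝓝 (0:E), ∃ Φ : E → E, ContDiff ℝ (⊤ : ℕ∞) Φ ∧ (∀ x ∉ V, Φ x = x) ∧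
    (∀ x, Φ x = 0 ↔ x = 0) ∧ (∀ x, IsUnit (fderiv ℝ Φ x)) ∧ fderiv ℝ Φ 0 = A

theorem LocExt.one {E : Type*} [NormedAddCommGroup E] [NormedSpace ℝ E] :
    LocExt (1 : E →L[ℝ] E) := by
  intro V _
  refine ⟨id, contDiff_id, fun _ _ => rfl, fun _ => Iff.rfl, fun x => ?_, ?_⟩
  · rw [fderiv_id]; exact isUnit_one
  · rw [fderiv_id]; rfl

theorem LocExt.mul {E : Type*} [NormedAddCommGroup E] [NormedSpace ℝ E] {A B : E →L[ℝ] E}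
    (hA : LocExt A) (hB : LocExt B) : LocExt (A * B) := by
  intro V hV
  obtain ⟨Φ, h1, h2, h3, h4, h5⟩ := hA V hV
  obtain ⟨Ψ, k1, k2, k3, k4, k5⟩ := hB V hV
  have hd : ∀ x, fderiv ℝ (Φ ∘ Ψ) x = fderiv ℝ Φ (Ψ x) * fderiv ℝ Ψ x := fun x =>
    fderiv_comp x (h1.differentiable (by simp) _) (k1.differentiable (by simp) _)
  refine ⟨Φ ∘ Ψ, h1.comp k1, fun x hx => ?_, fun x => ?_, fun x => ?_, ?_⟩
  · simp [k2 x hx, h2 x hx]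
  · simp [h3, k3]
  · rw [hd]; exact (h4 _).mul (k4 _)
  · rw [hd, (k3 0).2 rfl, h5, k5]

theorem LocExt.near_one (E : Type*) [NormedAddCommGroup E] [NormedSpace ℝ E]
    [FiniteDimensional ℝ E] : ∀ᶠ A in 𝓝 (1 : E →L[ℝ] E), LocExt A := by
  obtain ⟨M, hM0, hM⟩ := exists_bump E
  filter_upwards [Metric.ball_mem_nhds (1 : E →L[ℝ] E) (show 0 < 1 / (1 + M) by positivity)] with A hA
  intro V hV
  obtain ⟨δ, hδ, hball⟩ := Metric.mem_nhds_iff.1 hV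
  obtain ⟨χ, hχ, hχ1, hχ0, hχb, hχM⟩ := hM (δ / 4) (by positivity)
  set C : E →L[ℝ] E := A - 1 with hC
  have hCn : ‖C‖ * (1 + M) < 1 := by
    rw [Metric.mem_ball, dist_eq_norm, lt_div_iff₀ (by positivity)] at hA
    exact hA
  have hC1 : ‖C‖ < 1 := by nlinarith [norm_nonneg C]
  have hχd : Differentiable ℝ χ := hχ.differentiable (by simp)
  have hd : ∀ x, HasFDerivAt (fun x => x + χ x • C x)
      (1 + (χ x • C + (fderiv ℝ χ x).smulRight (C x))) x := fun x =>
    (hasFDerivAt_id x).add ((hχd x).hasFDerivAt.smul C.hasFDerivAt)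
  refine ⟨fun x => x + χ x • C x, contDiff_id.add (hχ.smul C.contDiff), fun x hx => ?_,
    fun x => ⟨fun h => ?_, ?_⟩, fun x => ?_, ?_⟩
  · have : δ ≤ ‖x‖ := by
      by_contra hc
      exact hx (hball (by simpa using hc))
    simp [hχ0 x (by linarith)]
  · by_contra hx0
    have hxp : 0 < ‖x‖ := norm_pos_iff.2 hx0
    have h1 : ‖x‖ ≤ ‖C‖ * ‖x‖ := by
      conv_lhs => rw [eq_neg_of_add_eq_zero_left h, norm_neg, norm_smul, Real.norm_eq_abs]
      calc |χ x| * ‖C x‖ ≤ 1 * (‖C‖ * ‖x‖) := by gcongr; exacts [hχb x, C.le_opNorm x]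
        _ = _ := one_mul _
    nlinarith
  · rintro rfl; simp
  · rw [(hd x).fderiv]
    have hn : ‖-(χ x • C + (fderiv ℝ χ x).smulRight (C x))‖ < 1 := by
      rw [norm_neg]
      refine lt_of_le_of_lt (norm_add_le _ _) ?_
      rw [norm_smul, Real.norm_eq_abs, ContinuousLinearMap.norm_smulRight_apply]
      have a1 : |χ x| * ‖C‖ ≤ 1 * ‖C‖ := by gcongr; exact hχb x
      have a2 : ‖fderiv ℝ χ x‖ * ‖C x‖ ≤ ‖C‖ * M :=
        calc _ ≤ ‖fderiv ℝ χ x‖ * (‖C‖ * ‖x‖) := by gcongr; exact C.le_opNorm x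
          _ = ‖C‖ * (‖fderiv ℝ χ x‖ * ‖x‖) := by ring
          _ ≤ _ := by gcongr; exact hχM x
      linarith
    have := (Units.oneSub _ hn).isUnit
    rwa [Units.val_oneSub, sub_neg_eq_add] at this
  · rw [(hd 0).fderiv, hχ1 0 (by simp; positivity)]
    simp [hC]

theorem LocExt.of_det_pos {n : ℕ} (T : (Fin n → ℝ) →ₗ[ℝ] (Fin n → ℝ)) (hT : 0 < LinearMap.det T) :
    LocExt (LinearMap.toContinuousLinearMap T) := by
  let L : Matrix (Fin n) (Fin n) ℝ →ₗ[ℝ] ((Fin n → ℝ) →L[ℝ] (Fin n → ℝ)) :=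
    (LinearMap.toContinuousLinearMap (𝕜 := ℝ) (E := Fin n → ℝ) (F' := Fin n → ℝ)).toLinearMap ∘ₗ
      (Matrix.toLin' (R := ℝ) (m := Fin n) (n := Fin n)).toLinearMap
  have hL1 : L 1 = 1 := by
    ext v; simp [L]
  have hLm : ∀ A B, L (A * B) = L A * L B := by
    intro A B
    ext v; simp [L]
  have hLc : Continuous L := L.continuous_of_finiteDimensional
  let S : Submonoid (Matrix (Fin n) (Fin n) ℝ) :=
    { carrier := {A | LocExt (L A)}
      one_mem' := by
        change LocExt (L 1)
        rw [hL1]; exact LocExt.one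
      mul_mem' := by
        intro A B hA hB
        change LocExt (L (A * B))
        rw [hLm]; exact LocExt.mul hA hB }
  have hS : ∀ᶠ A in 𝓝 (1 : Matrix (Fin n) (Fin n) ℝ), A ∈ S := by
    have h := hLc.tendsto 1
    rw [hL1] at h
    exact h.eventually (LocExt.near_one _)
  have := mem_of_det_pos S hS (LinearMap.toMatrix' T) (by rwa [LinearMap.det_toMatrix'])
  change LocExt (L (LinearMap.toMatrix' T)) at this
  simpa [L] using this

theorem exists_reflection {E : Type*} [AddCommGroup E] [Module ℝ E] [FiniteDimensional ℝ E]
    [Nontrivial E] (B : E →ₗ[ℝ] E →ₗ[ℝ] ℝ) (hs : ∀ v w, B v w = B w v)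
    (hnd : ∀ v, (∀ w, B v w = 0) → v = 0) :
    ∃ R : E →ₗ[ℝ] E, LinearMap.det R = -1 ∧ ∀ v w, B (R v) (R w) = B v w := by
  have : ∃ v, B v v ≠ 0 := by
    by_contra hc
    push Not at hc
    obtain ⟨v, hv⟩ := exists_ne (0 : E)
    apply hv
    apply hnd
    intro w
    have := hc (v + w)
    simp [hc, hs w v] at this
    exact this
  obtain ⟨v, hv⟩ := this
  refine ⟨LinearMap.transvection ((-2 / B v v) • B v) v, ?_, ?_⟩
  · rw [LinearMap.transvection.det]
    simp
    field_simp
    norm_num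
  · intro x y
    simp [LinearMap.transvection.apply, hs x v]
    field_simp
    ring

theorem pull_back {n : ℕ} (f : (Fin n → ℝ) → ℝ) (hf : ContDiff ℝ (⊤ : ℕ∞) f)
    (hfc : ∀ x, fderiv ℝ f x = 0 ↔ x = 0) (A : (Fin n → ℝ) →L[ℝ] (Fin n → ℝ)) (hA : LocExt A)
    (V : Set (Fin n → ℝ)) (hV : V ∈ 𝓝 0) :
    ∃ F : (Fin n → ℝ) → ℝ, ContDiff ℝ (⊤ : ℕ∞) F ∧ F 0 = f 0 ∧ (∀ x ∉ V, F x = f x) ∧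
      (∀ x, fderiv ℝ F x = 0 ↔ x = 0) ∧
      ∀ v w, fderiv ℝ (fderiv ℝ F) 0 v w = fderiv ℝ (fderiv ℝ f) 0 (A v) (A w) := by
  obtain ⟨Φ, h1, h2, h3, h4, h5⟩ := hA V hV
  have hd : ∀ x, fderiv ℝ (f ∘ Φ) x = (fderiv ℝ f (Φ x)).comp (fderiv ℝ Φ x) := fun x =>
    fderiv_comp x (hf.differentiable (by simp) _) (h1.differentiable (by simp) _)
  have hΦ0 : Φ 0 = 0 := (h3 0).2 rfl
  refine ⟨f ∘ Φ, hf.comp h1, by simp [hΦ0], fun x hx => by simp [h2 x hx], fun x => ?_, ?_⟩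
  · rw [hd]
    constructor
    · intro h
      rw [← h3, ← hfc]
      obtain ⟨u, hu⟩ := h4 x
      ext1 v
      have := congrArg (fun l => l ((↑u⁻¹ : (Fin n → ℝ) →L[ℝ] (Fin n → ℝ)) v)) h
      have h6 : (u : (Fin n → ℝ) →L[ℝ] (Fin n → ℝ)) ((↑u⁻¹ : (Fin n → ℝ) →L[ℝ] (Fin n → ℝ)) v) = v := by
        rw [← mul_apply_eq_comp, Units.mul_inv]; rfl
      simpa [← hu, h6] using this
    · rintro rfl
      rw [hΦ0, (hfc 0).2 rfl]; simp
  · intro v w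
    have hdf : ContDiff ℝ 1 (fderiv ℝ f) := hf.fderiv_right (by norm_cast)
    have hdΦ : ContDiff ℝ 1 (fderiv ℝ Φ) := h1.fderiv_right (by norm_cast)
    have e : fderiv ℝ (f ∘ Φ) = fun x => (fderiv ℝ f (Φ x)).comp (fderiv ℝ Φ x) := funext hd
    have k1 : HasFDerivAt (fun x => fderiv ℝ f (Φ x)) ((fderiv ℝ (fderiv ℝ f) 0).comp A) 0 := by
      have q1 : HasFDerivAt (fderiv ℝ f) (fderiv ℝ (fderiv ℝ f) 0) (Φ 0) := by
        rw [hΦ0]; exact (hdf.differentiable (by simp) 0).hasFDerivAt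
      have q2 : HasFDerivAt Φ A 0 := h5 ▸ (h1.differentiable (by simp) 0).hasFDerivAt
      exact q1.comp 0 q2
    have k2 := k1.clm_comp (hdΦ.differentiable (by simp) 0).hasFDerivAt
    rw [e, k2.fderiv]
    simp [hΦ0, (hfc 0).2 rfl, h5]

/-- Interpolation of Morse functions: if `f, g : ℝ^n → ℝ` are smooth with `f(0) = g(0) = 0`,
each having `0` as unique critical point with nondegenerate symmetric Hessian there, and the
Hessians are related by a linear automorphism (same Morse index), then for every neighborhood
`V` of `0` there is a smooth family `h_c` agreeing with `f` outside `V` and at `c = 0`,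
agreeing with `g` near `0` at `c = 1`, with `h_1` having `0` as unique critical point. -/
theorem stmt15 (n : ℕ) (hn : 1 ≤ n)
    (f g : (Fin n → ℝ) → ℝ)
    (hf : ContDiff ℝ (⊤ : ℕ∞) f) (hg : ContDiff ℝ (⊤ : ℕ∞) g)
    (hf0 : f 0 = 0) (hg0 : g 0 = 0)
    (hfc : ∀ x, fderiv ℝ f x = 0 ↔ x = 0)
    (hgc : ∀ x, fderiv ℝ g x = 0 ↔ x = 0)
    (hfsymm : ∀ v w, fderiv ℝ (fderiv ℝ f) 0 v w = fderiv ℝ (fderiv ℝ f) 0 w v)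
    (hgsymm : ∀ v w, fderiv ℝ (fderiv ℝ g) 0 v w = fderiv ℝ (fderiv ℝ g) 0 w v)
    (hfnd : ∀ v, (∀ w, fderiv ℝ (fderiv ℝ f) 0 v w = 0) → v = 0)
    (hgnd : ∀ v, (∀ w, fderiv ℝ (fderiv ℝ g) 0 v w = 0) → v = 0)
    (hindex : ∃ T : (Fin n → ℝ) ≃ₗ[ℝ] (Fin n → ℝ),
      ∀ v w, fderiv ℝ (fderiv ℝ g) 0 v w = fderiv ℝ (fderiv ℝ f) 0 (T v) (T w))
    (V : Set (Fin n → ℝ)) (hV : IsOpen V) (h0V : (0 : Fin n → ℝ) ∈ V) :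
    ∃ h : (Fin n → ℝ) × ℝ → ℝ, ContDiff ℝ (⊤ : ℕ∞) h ∧
      (∀ x ∉ V, ∀ c ∈ Set.Icc (0 : ℝ) 1, h (x, c) = f x) ∧
      (∀ x, h (x, 0) = f x) ∧
      (∃ U : Set (Fin n → ℝ), IsOpen U ∧ (0 : Fin n → ℝ) ∈ U ∧ ∀ x ∈ U, h (x, 1) = g x) ∧
      (∀ x, fderiv ℝ (fun y => h (y, 1)) x = 0 ↔ x = 0) := by
  obtain ⟨T, hT⟩ := hindex
  have hVn : V ∈ 𝓝 (0 : Fin n → ℝ) := hV.mem_nhds h0V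
  have hT' : ∃ T : (Fin n → ℝ) →ₗ[ℝ] (Fin n → ℝ), 0 < LinearMap.det T ∧
      ∀ v w, fderiv ℝ (fderiv ℝ g) 0 v w = fderiv ℝ (fderiv ℝ f) 0 (T v) (T w) := by
    have hdet : LinearMap.det (T : (Fin n → ℝ) →ₗ[ℝ] (Fin n → ℝ)) ≠ 0 := T.isUnit_det'.ne_zero
    rcases lt_or_gt_of_ne hdet with hneg | hpos
    · haveI : Nonempty (Fin n) := ⟨⟨0, hn⟩⟩
      obtain ⟨R, hR1, hR2⟩ := exists_reflection
        (ContinuousLinearMap.coeLM ℝ ∘ₗ (fderiv ℝ (fderiv ℝ f) 0).toLinearMap) (by simpa using hfsymm)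
        (by simpa using hfnd)
      refine ⟨R ∘ₗ T.toLinearMap, ?_, ?_⟩
      · rw [LinearMap.det_comp, hR1]; linarith
      · intro v w
        rw [hT]
        exact (hR2 (T v) (T w)).symm
    · exact ⟨T, hpos, hT⟩
  obtain ⟨A, hA, hAB⟩ := hT'
  obtain ⟨F₁, a1, a2, a3, a4, a5⟩ := pull_back f hf hfc _ (LocExt.of_det_pos A hA) V hVn
  have hH : fderiv ℝ (fderiv ℝ g) 0 = fderiv ℝ (fderiv ℝ F₁) 0 := by
    ext1 v
    ext1 w
    rw [a5, hAB]; rfl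
  obtain ⟨F, b1, b2, b3, b4⟩ := same_hessian F₁ g a1 hg (a2.trans hf0) hg0 a4 ((hgc 0).2 rfl)
    (by rw [← hH]; exact hgnd) hH V hVn
  obtain ⟨U, hU, hUo, hU0⟩ := eventually_nhds_iff.1 b3
  refine ⟨fun p => (1 - p.2) * f p.1 + p.2 * F p.1, ?_, ?_, ?_, ⟨U, hUo, hU0, ?_⟩, ?_⟩
  · exact ((contDiff_const.sub contDiff_snd).mul (hf.comp contDiff_fst)).add
      (contDiff_snd.mul (b1.comp contDiff_fst))
  · intro x hx c _
    simp only [b2 x hx, a3 x hx]; ring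
  · intro x; simp
  · intro x hx; simp [hU x hx]
  · intro x; simpa using b4 x
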